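/- arXiv:1403.7659 — 3 statements merged into one kernel-verified Lean document; each statement's English description precedes it below -/
import Mathlib

section
/- Let p be a prime, F a finite field of characteristic p, and a : ℕ → F a sequence. The formal power series f = ∑_{n≥0} a(n)·xⁿ ∈ F[[x]] is algebraic over F(x) — i.e., there exists a nonzero polynomial P in two variables with coefficients in F such that P(x, f) = 0 in F[[x]] — if and only if the sequence a is p-automatic. (Christol's theorem.) -/
/-- A sequence with values in `A` is `k`-automatic if its `k`-kernel, the set of
sequences `n ↦ b (k^e * n + r)` for `e ≥ 0` and `0 ≤ r < k^e`, is finite. -/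
def IsKAutomatic {A : Type*} (k : ℕ) (b : ℕ → A) : Prop :=
  {g : ℕ → A | ∃ e r : ℕ, r < k ^ e ∧ g = fun n => b (k ^ e * n + r)}.Finite

open Polynomial in
/-- A pair `(x, f)` of power series satisfies a nonzero polynomial relation over `F` if and only if
`f` is algebraic over `F[x]`. -/
theorem exists_aeval_X_eq_zero_iff_isAlgebraic {F : Type*} [Field F] (f : PowerSeries F) :
    (∃ P : MvPolynomial (Fin 2) F, P ≠ 0 ∧ MvPolynomial.aeval ![PowerSeries.X, f] P = 0) ↔
      IsAlgebraic F[X] f := by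
  have key (P : F[X][X]) :
      MvPolynomial.aeval ![PowerSeries.X, f] (Bivariate.equivMvPolynomial F P) = aeval f P := by
    induction P using Polynomial.induction_on' with
    | add P Q hP hQ => simp [hP, hQ]
    | monomial n P =>
      induction P using Polynomial.induction_on' with
      | add P Q hP hQ => rw [map_add, map_add, map_add, map_add, hP, hQ]
      | monomial m c =>
        simp_rw [← Polynomial.C_mul_X_pow_eq_monomial]
        simp [PowerSeries.algebraMap_apply']
  constructor
  · rintro ⟨P, hP, h⟩
    refine ⟨(Bivariate.equivMvPolynomial F).symm P, by simpa using hP, ?_⟩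
    rw [← key, AlgEquiv.apply_symm_apply, h]
  · rintro ⟨P, hP, h⟩
    exact ⟨Bivariate.equivMvPolynomial F P, by simpa using hP, by rw [key, h]⟩

/-- The kernel of a sequence `b` is finite as soon as `b` lies in some finite set stable under
all the maps `g ↦ (n ↦ g (k * n + r))` with `r < k`. -/
theorem IsKAutomatic.of_finite_stable {A : Type*} {k : ℕ} {b : ℕ → A} {T : Set (ℕ → A)}
    (hT : T.Finite) (hb : b ∈ T) (hstab : ∀ g ∈ T, ∀ r < k, (fun n => g (k * n + r)) ∈ T) :
    IsKAutomatic k b := by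
  refine hT.subset ?_
  rintro _ ⟨e, r, hr, rfl⟩
  induction e generalizing r with
  | zero =>
    obtain rfl : r = 0 := by simpa using hr
    simpa using hb
  | succ e ih =>
    have hpos : 0 < k ^ e := Nat.pos_of_ne_zero fun h => by simp [pow_succ, h] at hr
    have hr' : r / k ^ e < k := Nat.div_lt_of_lt_mul (by rwa [← pow_succ])
    convert hstab _ (ih (r % k ^ e) (Nat.mod_lt _ hpos)) _ hr' using 3 with n
    conv_lhs => rw [← Nat.div_add_mod r (k ^ e)]
    ring

/-- The kernel of `b` contains `b` and is stable under `g ↦ (n ↦ g (k * n + r))` for `r < k`. -/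
theorem IsKAutomatic.exists_finite_stable {A : Type*} {k : ℕ} {b : ℕ → A}
    (h : IsKAutomatic k b) :
    ∃ T : Set (ℕ → A), T.Finite ∧ b ∈ T ∧ ∀ g ∈ T, ∀ r < k, (fun n => g (k * n + r)) ∈ T := by
  refine ⟨_, h, ⟨0, 0, by simp, by simp⟩, ?_⟩
  rintro _ ⟨e, s, hs, rfl⟩ r hr
  refine ⟨e + 1, k ^ e * r + s, ?_, ?_⟩
  · calc k ^ e * r + s < k ^ e * r + k ^ e := by gcongr
      _ = k ^ e * (r + 1) := by ring
      _ ≤ k ^ (e + 1) := by rw [pow_succ]; gcongr; omega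
  · exact funext fun n => congrArg b (by ring)

/-- Being automatic does not change when the base is replaced by a positive power. -/
theorem isKAutomatic_pow_iff {A : Type*} {k s : ℕ} (hs : 0 < s) {b : ℕ → A} :
    IsKAutomatic (k ^ s) b ↔ IsKAutomatic k b := by
  constructor
  · intro h
    have hfin := (Set.finite_Iio s).biUnion fun t _ => (Set.finite_Iio (k ^ t)).biUnion fun r _ =>
      h.image fun g n => g (k ^ t * n + r)
    refine hfin.subset ?_
    rintro _ ⟨e, r, hr, rfl⟩
    have he : k ^ e = (k ^ s) ^ (e / s) * k ^ (e % s) := by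
      rw [← pow_mul, ← pow_add, Nat.div_add_mod]
    have hpos : 0 < (k ^ s) ^ (e / s) := Nat.pos_of_ne_zero fun h => by simp [he, h] at hr
    simp only [Set.mem_iUnion]
    refine ⟨e % s, Nat.mod_lt _ hs, r / (k ^ s) ^ (e / s), Nat.div_lt_of_lt_mul (by rwa [← he]),
      _, ⟨e / s, r % (k ^ s) ^ (e / s), Nat.mod_lt _ hpos, rfl⟩, ?_⟩
    refine funext fun n => congrArg b ?_
    conv_rhs => rw [← Nat.div_add_mod r ((k ^ s) ^ (e / s)), he]
    ring
  · intro h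
    refine h.subset ?_
    rintro _ ⟨e, r, hr, rfl⟩
    exact ⟨s * e, r, by rwa [pow_mul], by rw [pow_mul]⟩

namespace PowerSeries

/-- The operator sending `∑ aₙ xⁿ` to `∑ a_{qn+r} xⁿ`. -/
noncomputable def cartier {R : Type*} [Semiring R] (q r : ℕ) : PowerSeries R →+ PowerSeries R where
  toFun f := mk fun n => coeff (q * n + r) f
  map_zero' := by ext; simp
  map_add' f g := by ext; simp

@[simp]
theorem coeff_cartier {R : Type*} [Semiring R] (q r n : ℕ) (f : PowerSeries R) :
    coeff n (cartier q r f) = coeff (q * n + r) f := by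
  simp [cartier]

theorem cartier_X_pow_mul_expand {R : Type*} [CommRing R] {q : ℕ} (hq : q ≠ 0) {r s : ℕ}
    (hr : r < q) (hs : s < q) (g : PowerSeries R) :
    cartier q r (X ^ s * expand q hq g) = if s = r then g else 0 := by
  ext n
  rw [coeff_cartier, coeff_X_pow_mul', coeff_expand]
  split_ifs with h₁ h₂ h₃ h₃ h₃ <;> try rfl
  · subst h₃
    simp [Nat.pos_of_ne_zero hq]
  · refine absurd ?_ h₃
    have := (Nat.modEq_iff_dvd' h₁).2 h₂
    simpa [Nat.ModEq, Nat.mod_eq_of_lt hr, Nat.mod_eq_of_lt hs] using this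
  · subst h₃
    simp at h₂
  · omega

theorem eq_sum_X_pow_mul_expand_cartier {R : Type*} [CommRing R] {q : ℕ} (hq : q ≠ 0)
    (f : PowerSeries R) :
    f = ∑ s ∈ Finset.range q, X ^ s * expand q hq (cartier q s f) := by
  have h (g : PowerSeries R) (m : ℕ) :
      coeff m g = coeff (m / q) (cartier q (m % q) g) := by
    rw [coeff_cartier, Nat.div_add_mod]
  ext m
  have hm : m % q < q := Nat.mod_lt _ (Nat.pos_of_ne_zero hq)
  rw [h, h (∑ s ∈ _, _), map_sum, Finset.sum_congr rfl fun s hs =>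
    cartier_X_pow_mul_expand hq hm (Finset.mem_range.1 hs) _]
  simp [hm]

theorem cartier_mul_expand {R : Type*} [CommRing R] {q : ℕ} (hq : q ≠ 0) {r : ℕ} (hr : r < q)
    (f g : PowerSeries R) : cartier q r (f * expand q hq g) = cartier q r f * g := by
  conv_lhs => rw [eq_sum_X_pow_mul_expand_cartier hq f]
  rw [Finset.sum_mul, map_sum, Finset.sum_congr rfl fun s hs => by
    rw [mul_assoc, ← map_mul, cartier_X_pow_mul_expand hq hr (Finset.mem_range.1 hs)]]
  simp [hr]

section FiniteField

variable {F : Type*} [Field F] [Fintype F]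

theorem expand_card (f : PowerSeries F) :
    expand (Fintype.card F) Fintype.card_ne_zero f = f ^ Fintype.card F := by
  obtain ⟨p, _, n, hp, hn⟩ := FiniteField.card' F
  have : Fact p.Prime := ⟨hp⟩
  have hfrob : iterateFrobenius F p n = RingHom.id F := by
    ext x
    rw [iterateFrobenius_def, ← hn, FiniteField.pow_card, RingHom.id_apply]
  have h := MvPowerSeries.map_iterateFrobenius_expand p hp.ne_zero f (n : ℕ)
  rw [hfrob, MvPowerSeries.map_id] at h
  simp only [hn]
  exact h

theorem sum_pow_card_pow {ι : Type*} (s : Finset ι) (f : ι → PowerSeries F) (j : ℕ) :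
    (∑ i ∈ s, f i) ^ Fintype.card F ^ j = ∑ i ∈ s, f i ^ Fintype.card F ^ j := by
  induction j with
  | zero => simp
  | succ j ih => simp_rw [pow_succ, pow_mul, ih, ← expand_card, map_sum]

theorem cartier_mul_pow_card {r : ℕ} (hr : r < Fintype.card F) (f g : PowerSeries F) :
    cartier (Fintype.card F) r (f * g ^ Fintype.card F) = cartier (Fintype.card F) r f * g := by
  rw [← expand_card, cartier_mul_expand _ hr]

theorem eq_sum_X_pow_mul_cartier_pow_card (f : PowerSeries F) :
    f = ∑ s ∈ Finset.range (Fintype.card F),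
      X ^ s * cartier (Fintype.card F) s f ^ Fintype.card F := by
  simp_rw [← expand_card]
  exact eq_sum_X_pow_mul_expand_cartier _ f

end FiniteField

end PowerSeries

/-- The polynomial version of `PowerSeries.cartier`. -/
noncomputable def Polynomial.cartier {R : Type*} [Semiring R] (q r : ℕ) (P : Polynomial R) :
    Polynomial R :=
  PowerSeries.trunc (P.natDegree / q + 1) (PowerSeries.cartier q r P)

theorem Polynomial.natDegree_cartier_le {R : Type*} [Semiring R] (q r : ℕ) (P : Polynomial R) :
    (P.cartier q r).natDegree ≤ P.natDegree / q :=
  Nat.lt_succ_iff.1 (PowerSeries.natDegree_trunc_lt _ _)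

theorem Polynomial.coe_cartier {R : Type*} [Semiring R] {q : ℕ} (hq : 0 < q) (r : ℕ)
    (P : Polynomial R) : (P.cartier q r : PowerSeries R) = PowerSeries.cartier q r P := by
  ext n
  rw [Polynomial.cartier, Polynomial.coeff_coe, PowerSeries.coeff_trunc]
  split_ifs with h
  · rfl
  · rw [PowerSeries.coeff_cartier, Polynomial.coeff_coe, Polynomial.coeff_eq_zero_of_natDegree_lt]
    rw [not_lt, Nat.succ_le_iff, Nat.div_lt_iff_lt_mul hq, mul_comm] at h
    omega

namespace PowerSeries

open Polynomial

variable {F : Type*} [Field F]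

theorem polynomial_smul_eq_mul (P : F[X]) (f : PowerSeries F) : P • f = (P : PowerSeries F) * f := by
  rw [Algebra.smul_def, algebraMap_apply']
  simp

/-- An algebraic power series satisfies a nontrivial relation linear in its `q ^ i`-th powers. -/
theorem exists_additive_relation_of_isAlgebraic {f : PowerSeries F} (hf : IsAlgebraic F[X] f)
    (q : ℕ) :
    ∃ (d : ℕ) (B : Fin d → F[X]), B ≠ 0 ∧
      ∑ i, (B i : PowerSeries F) * f ^ q ^ (i : ℕ) = 0 := by
  obtain ⟨c, hc, hint⟩ := hf.exists_integral_multiple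
  obtain ⟨w, hw⟩ := hint.fg_adjoin_singleton
  have hdep : ¬ LinearIndependent F[X] fun i : Fin (w.card + 1) => (c • f) ^ q ^ (i : ℕ) := by
    intro h
    have := linearIndependent_le_span' _ h (w : Set (PowerSeries F)) (by
      rw [hw]
      rintro _ ⟨i, rfl⟩
      exact pow_mem (Algebra.self_mem_adjoin_singleton _ _) _)
    simp at this
  obtain ⟨B, hB, i, hi⟩ := Fintype.not_linearIndependent_iff.1 hdep
  refine ⟨w.card + 1, fun i => B i * c ^ q ^ (i : ℕ), fun h => ?_, ?_⟩
  · exact mul_ne_zero hi (pow_ne_zero _ hc) (congrFun h i)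
  · rw [← hB]
    refine Finset.sum_congr rfl fun i _ => ?_
    simp only [polynomial_smul_eq_mul, Polynomial.coe_mul, Polynomial.coe_pow]
    ring

variable [Fintype F]

local notation "q" => Fintype.card F

/-- A nontrivial relation between the `q ^ i`-th powers can be made separable. -/
theorem exists_separable_relation {f : PowerSeries F} {d : ℕ} {B : Fin d → F[X]} (hB : B ≠ 0)
    (h : ∑ i, (B i : PowerSeries F) * f ^ q ^ (i : ℕ) = 0) :
    ∃ (d : ℕ) (c : F[X]) (b : Fin d → F[X]), c ≠ 0 ∧
      (c : PowerSeries F) * f = ∑ i, (b i : PowerSeries F) * f ^ q ^ (i + 1 : ℕ) := by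
  induction d with
  | zero => exact absurd (Subsingleton.elim _ _) hB
  | succ d ih =>
    rw [Fin.sum_univ_succ] at h
    by_cases h₀ : B 0 = 0
    · obtain ⟨i, hi⟩ : ∃ i : Fin d, B i.succ ≠ 0 := by
        by_contra! hall
        exact hB (funext (Fin.cases h₀ hall))
      obtain ⟨n, hn⟩ : ∃ n, (B i.succ).coeff n ≠ 0 := by
        by_contra! hall
        exact hi (Polynomial.ext hall)
      have hr : n % q < q := Nat.mod_lt _ Fintype.card_pos
      refine ih (B := fun i => (B i.succ).cartier q (n % q)) (fun h => hn ?_) ?_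
      · have := congrArg (fun P : F[X] => coeff (n / q) (P : PowerSeries F)) (congrFun h i)
        simpa [Polynomial.coe_cartier Fintype.card_pos, Nat.div_add_mod] using this
      · have := congrArg (cartier q (n % q)) h
        simp only [h₀, Polynomial.coe_zero, zero_mul, zero_add, map_sum, map_zero, Fin.val_succ,
          pow_succ, pow_mul, cartier_mul_pow_card hr] at this
        simpa only [Polynomial.coe_cartier Fintype.card_pos] using this
    · refine ⟨d, B 0, fun i => -B i.succ, h₀, ?_⟩
      simp only [Fin.val_zero, pow_zero, pow_one, Fin.val_succ] at h
      simpa using eq_neg_of_add_eq_zero_left h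

/-- The power series `h` such that `c ^ q ^ (d + 1) * h` is a combination of the power series
`c ^ (q ^ (d + 1) - q ^ i) * f ^ q ^ i`, for `i ≤ d`, with polynomial coefficients of degree at
most `N`. -/
def boundedCombinations (f : PowerSeries F) (c : F[X]) (d N : ℕ) : Set (PowerSeries F) :=
  {h | ∃ D : Fin (d + 1) → F[X], (∀ i, (D i).natDegree ≤ N) ∧
    (c : PowerSeries F) ^ q ^ (d + 1) * h =
      ∑ i, (D i : PowerSeries F) * (c ^ (q ^ (d + 1) - q ^ (i : ℕ)) * f ^ q ^ (i : ℕ))}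

theorem finite_setOf_natDegree_le (N : ℕ) : {P : F[X] | P.natDegree ≤ N}.Finite := by
  have : Finite (degreeLT F (N + 1)) := Finite.of_equiv _ (degreeLTEquiv F (N + 1)).toEquiv.symm
  refine (Set.toFinite (degreeLT F (N + 1) : Set F[X])).subset fun P hP => ?_
  rw [SetLike.mem_coe, mem_degreeLT]
  exact (natDegree_le_iff_degree_le.1 hP).trans_lt (by exact_mod_cast N.lt_succ_self)

theorem finite_boundedCombinations (f : PowerSeries F) {c : F[X]} (hc : c ≠ 0) (d N : ℕ) :
    (boundedCombinations f c d N).Finite := by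
  have hc' : (c : PowerSeries F) ≠ 0 := by simpa using hc
  refine Set.Finite.of_finite_image (f := ((c : PowerSeries F) ^ q ^ (d + 1) * ·)) ?_
    (mul_right_injective₀ (pow_ne_zero _ hc')).injOn
  refine ((Set.Finite.pi' fun _ : Fin (d + 1) => finite_setOf_natDegree_le (F := F) N).image
    fun D : Fin (d + 1) → F[X] => ∑ i : Fin (d + 1), (D i : PowerSeries F) *
      (c ^ (q ^ (d + 1) - q ^ (i : ℕ)) * f ^ q ^ (i : ℕ))).subset ?_
  rintro _ ⟨h, ⟨D, hD, hh⟩, rfl⟩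
  exact ⟨D, hD, hh.symm⟩

theorem self_mem_boundedCombinations (f : PowerSeries F) {c : F[X]} {d N : ℕ}
    (hN : c.natDegree ≤ N) : f ∈ boundedCombinations f c d N := by
  refine ⟨Fin.cons c 0, Fin.cases (by simpa using hN) (by simp), ?_⟩
  have : q ^ (d + 1) = q ^ (d + 1) - 1 + 1 :=
    (Nat.sub_add_cancel (Nat.one_le_pow _ _ Fintype.card_pos)).symm
  simp only [Fin.sum_univ_succ, Fin.cons_zero, Fin.cons_succ, Fin.val_zero, Pi.zero_apply,
    Polynomial.coe_zero, zero_mul, Finset.sum_const_zero, add_zero, pow_zero, pow_one]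
  conv_lhs => rw [this]
  ring

theorem cartier_mem_boundedCombinations {f : PowerSeries F} {c : F[X]} {d N : ℕ}
    {b : Fin d → F[X]}
    (hf : (c : PowerSeries F) * f = ∑ i, (b i : PowerSeries F) * f ^ q ^ (i + 1 : ℕ))
    (hN : ∀ i, (b i * c ^ (q ^ (i + 1 : ℕ) - 2)).natDegree ≤ N) {h : PowerSeries F}
    (hh : h ∈ boundedCombinations f c d N) {r : ℕ} (hr : r < q) :
    cartier q r h ∈ boundedCombinations f c d N := by
  obtain ⟨D, hD, hh⟩ := hh
  have hq : 2 ≤ q := Fintype.one_lt_card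
  have two_le (i : ℕ) : 2 ≤ q ^ (i + 1) := hq.trans (Nat.le_self_pow i.succ_ne_zero _)
  have pow_le {i j : ℕ} (hij : i ≤ j) : q ^ i ≤ q ^ j := Nat.pow_le_pow_right (by omega) hij
  let E (i : Fin d) : F[X] := D i.succ + D 0 * (b i * c ^ (q ^ (i + 1 : ℕ) - 2))
  have hE (i : Fin d) : (E i).natDegree ≤ N * 2 := by
    refine (natDegree_add_le _ _).trans (max_le ((hD _).trans (by omega)) ?_)
    exact natDegree_mul_le.trans (by linarith [hD 0, hN i])
  have hsum : h * ((c : PowerSeries F) ^ q ^ d) ^ q =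
      ∑ i, (E i : PowerSeries F) * (c ^ (q ^ d - q ^ (i : ℕ)) * f ^ q ^ (i : ℕ)) ^ q := by
    have hfirst : (c : PowerSeries F) ^ (q ^ (d + 1) - 1) * f =
        ∑ i, (b i * c ^ (q ^ (i + 1 : ℕ) - 2) : PowerSeries F) *
          (c ^ (q ^ (d + 1) - q ^ (i + 1 : ℕ)) * f ^ q ^ (i + 1 : ℕ)) := by
      rw [show q ^ (d + 1) - 1 = q ^ (d + 1) - 2 + 1 by have := two_le d; omega, pow_succ,
        mul_assoc, hf, Finset.mul_sum]
      refine Finset.sum_congr rfl fun i _ => ?_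
      rw [show q ^ (d + 1) - 2 = q ^ (i + 1 : ℕ) - 2 + (q ^ (d + 1) - q ^ (i + 1 : ℕ)) by
        have := two_le i
        have := pow_le (i := i + 1) (j := d + 1) (by omega)
        omega, pow_add]
      ring
    rw [← pow_mul, ← pow_succ, mul_comm, hh, Fin.sum_univ_succ]
    simp only [Fin.val_zero, pow_zero, pow_one, Fin.val_succ]
    rw [hfirst, Finset.mul_sum, ← Finset.sum_add_distrib]
    refine Finset.sum_congr rfl fun i _ => ?_
    rw [mul_pow, ← pow_mul, ← pow_mul, ← pow_succ, Nat.sub_mul, ← pow_succ, ← pow_succ]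
    simp only [E, Polynomial.coe_add, Polynomial.coe_mul, Polynomial.coe_pow]
    ring
  replace hsum := congrArg (cartier q r) hsum
  simp only [map_sum, cartier_mul_pow_card hr] at hsum
  refine ⟨Fin.snoc (α := fun _ => F[X]) (fun i => (E i).cartier q r) 0, ?_, ?_⟩
  · refine Fin.lastCases (by simp) fun i => ?_
    rw [Fin.snoc_castSucc]
    refine (natDegree_cartier_le _ _ _).trans (Nat.div_le_of_le_mul ?_)
    nlinarith [hE i]
  · rw [Fin.sum_univ_castSucc, show q ^ (d + 1) = q ^ (d + 1) - q ^ d + q ^ d from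
      (Nat.sub_add_cancel (pow_le d.le_succ)).symm, pow_add, mul_assoc, mul_comm (_ ^ q ^ d), hsum,
      Finset.mul_sum, Fin.snoc_last, Polynomial.coe_zero, zero_mul, add_zero]
    refine Finset.sum_congr rfl fun i _ => ?_
    rw [Fin.snoc_castSucc, Polynomial.coe_cartier Fintype.card_pos, Fin.val_castSucc,
      show q ^ (d + 1) - q ^ d + q ^ d - q ^ (i : ℕ) =
        q ^ (d + 1) - q ^ d + (q ^ d - q ^ (i : ℕ)) by
          have := pow_le i.is_lt.le
          omega, pow_add]
    ring

theorem isKAutomatic_of_isAlgebraic {a : ℕ → F} (h : IsAlgebraic F[X] (mk a)) :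
    IsKAutomatic q a := by
  obtain ⟨_, B, hB, hrel⟩ := exists_additive_relation_of_isAlgebraic h q
  obtain ⟨d, c, b, hc, hf⟩ := exists_separable_relation hB hrel
  let N := max c.natDegree (Finset.univ.sup fun i => (b i * c ^ (q ^ (i + 1 : ℕ) - 2)).natDegree)
  refine .of_finite_stable (T := {g | mk g ∈ boundedCombinations (mk a) c d N})
    ((finite_boundedCombinations (mk a) hc d N).preimage fun g _ g' _ hg => ?_)
    (self_mem_boundedCombinations _ (le_max_left _ _)) fun g hg r hr => ?_
  · ext n
    simpa using congrArg (coeff n) hg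
  · have hmk : mk (fun n => g (q * n + r)) = cartier q r (mk g) := by
      ext n
      simp
    rw [Set.mem_ofPred_eq, hmk]
    refine cartier_mem_boundedCombinations hf (fun i => ?_) hg hr
    exact (Finset.le_sup (f := fun i => (b i * c ^ (q ^ (i + 1 : ℕ) - 2)).natDegree)
      (Finset.mem_univ i)).trans (le_max_right _ _)

theorem isAlgebraic_of_isKAutomatic {a : ℕ → F} (h : IsKAutomatic q a) :
    IsAlgebraic F[X] (mk a) := by
  classical
  obtain ⟨T, hT, ha, hstab⟩ := h.exists_finite_stable
  let M (j : ℕ) : Submodule F[X] (PowerSeries F) :=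
    Submodule.span F[X] ((fun g => mk g ^ q ^ j) '' T)
  have hM : Monotone M := by
    refine monotone_nat_of_le_succ fun j => Submodule.span_le.2 ?_
    rintro _ ⟨g, hg, rfl⟩
    simp only [SetLike.mem_coe]
    rw [eq_sum_X_pow_mul_cartier_pow_card (mk g), sum_pow_card_pow]
    refine Submodule.sum_mem _ fun s hs => ?_
    convert Submodule.smul_mem (M (j + 1)) (Polynomial.X ^ (s * q ^ j))
      (Submodule.subset_span ⟨_, hstab g hg s (Finset.mem_range.1 hs), rfl⟩) using 1
    rw [polynomial_smul_eq_mul, Polynomial.coe_pow, Polynomial.coe_X, mul_pow, ← pow_mul,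
      ← pow_mul, ← pow_succ']
    congr 2
    ext n
    simp
  by_contra htr
  have hpow : LinearIndependent F[X] fun n : ℕ => mk a ^ n := by
    have := (Polynomial.basisMonomials F[X]).linearIndependent.map'
      (Polynomial.aeval (mk a)).toLinearMap
      (LinearMap.ker_eq_bot.2 (transcendental_iff_injective.1 htr))
    simpa [Function.comp_def] using this
  have hind := hpow.comp (fun i : Fin (hT.toFinset.card + 1) => q ^ (i : ℕ))
    ((Nat.pow_right_injective Fintype.one_lt_card).comp Fin.val_injective)
  have hle := linearIndependent_le_span' _ hind
    (hT.toFinset.image fun g => mk g ^ q ^ hT.toFinset.card : Finset (PowerSeries F)) (by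
      rintro _ ⟨i, rfl⟩
      simpa [M] using hM (Nat.lt_succ_iff.1 i.2) (Submodule.subset_span ⟨a, ha, rfl⟩))
  have := Finset.card_image_le (s := hT.toFinset) (f := fun g => mk g ^ q ^ hT.toFinset.card)
  simp only [Cardinal.mk_fin, Nat.cast_le, Finset.coe_sort_coe, Fintype.card_coe] at hle
  omega

end PowerSeries

/-- Christol's theorem: for `F` a finite field of characteristic `p`, the power series
`∑ a(n) xⁿ ∈ F[[x]]` is algebraic over `F(x)` iff `a` is `p`-automatic. -/
theorem christol (p : ℕ) [Fact p.Prime] (F : Type*) [Field F] [Fintype F] [CharP F p]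
    (a : ℕ → F) :
    (∃ P : MvPolynomial (Fin 2) F, P ≠ 0 ∧
        MvPolynomial.aeval ![PowerSeries.X, PowerSeries.mk a] P = 0) ↔
      IsKAutomatic p a := by
  obtain ⟨n, -, hn⟩ := FiniteField.card F p
  rw [exists_aeval_X_eq_zero_iff_isAlgebraic, ← isKAutomatic_pow_iff n.pos, ← hn]
  exact ⟨PowerSeries.isKAutomatic_of_isAlgebraic, PowerSeries.isAlgebraic_of_isKAutomatic⟩
end

section
/- Let p be a prime and a : ℕ → ℤ_p a sequence. Suppose that for every α ≥ 0 there is exactly one shift-invariant Borel probability measure μ_α on (ℤ/p^αℤ)^ℕ with μ_α(X_{a_α}) = 1 (i.e., the shift on the orbit closure of a_α is uniquely ergodic). Then there is exactly one shift-invariant Borel probability measure μ on ℤ_p^ℕ with μ(X_a) = 1, i.e., the shift on the orbit closure X_a of a is uniquely ergodic. -/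
open MeasureTheory

/-- The shift map on one-sided sequences. -/
def shift {A : Type*} (x : ℕ → A) : ℕ → A := fun n => x (n + 1)

/-- The shift-orbit closure of a sequence. -/
def orbitClosure {A : Type*} [TopologicalSpace A] (b : ℕ → A) : Set (ℕ → A) :=
  closure {y : ℕ → A | ∃ n : ℕ, y = shift^[n] b}

noncomputable instance (p : ℕ) [Fact p.Prime] : MeasurableSpace ℤ_[p] := borel _

instance (p : ℕ) [Fact p.Prime] : BorelSpace ℤ_[p] := ⟨rfl⟩

open Filter Topology
open scoped BoundedContinuousFunction

/-- The uniform probability measure on the first `N + 1` points of the orbit of `x`. -/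
noncomputable def empiricalMeasure {E : Type*} [MeasurableSpace E] (T : E → E) (x : E) (N : ℕ) :
    Measure E :=
  ((N + 1 : ℕ) : ENNReal)⁻¹ • ∑ k ∈ Finset.range (N + 1), Measure.dirac (T^[k] x)

instance {E : Type*} [MeasurableSpace E] (T : E → E) (x : E) (N : ℕ) :
    IsProbabilityMeasure (empiricalMeasure T x N) := by
  refine ⟨?_⟩
  simp only [empiricalMeasure, Measure.smul_apply, Measure.coe_finsetSum, Finset.sum_apply,
    measure_univ, Finset.sum_const, Finset.card_range, nsmul_eq_mul, mul_one, smul_eq_mul]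
  exact ENNReal.inv_mul_cancel (by simp) (ENNReal.natCast_ne_top _)

theorem empiricalMeasure_apply_eq_one {E : Type*} [MeasurableSpace E] {T : E → E} {x : E}
    {s : Set E} (hs : ∀ k, T^[k] x ∈ s) (N : ℕ) : empiricalMeasure T x N s = 1 := by
  simp only [empiricalMeasure, Measure.smul_apply, Measure.coe_finsetSum, Finset.sum_apply,
    Measure.dirac_apply_of_mem (hs _), Finset.sum_const, Finset.card_range, nsmul_eq_mul, mul_one,
    smul_eq_mul]
  exact ENNReal.inv_mul_cancel (by simp) (ENNReal.natCast_ne_top _)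

theorem integral_empiricalMeasure {E : Type*} [TopologicalSpace E] [MeasurableSpace E]
    [OpensMeasurableSpace E] (T : E → E) (x : E) (N : ℕ) (f : E →ᵇ ℝ) :
    ∫ y, f y ∂(empiricalMeasure T x N) = birkhoffAverage ℝ T f (N + 1) x := by
  rw [empiricalMeasure, integral_smul_measure, integral_finsetSum_measure fun _ _ ↦ f.integrable _]
  simp only [integral_dirac' _ _ f.continuous.stronglyMeasurable]
  simp [birkhoffAverage, birkhoffSum, ENNReal.toReal_add]

/-- **Krylov–Bogolyubov**: the orbit closure of a point under a continuous self-map of a compact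
metrizable space carries an invariant probability measure. -/
theorem exists_invariant_probabilityMeasure_closure_orbit {E : Type*} [TopologicalSpace E]
    [CompactSpace E] [T2Space E] [TopologicalSpace.PseudoMetrizableSpace E] [MeasurableSpace E]
    [BorelSpace E] {T : E → E} (hT : Continuous T) (x : E) :
    ∃ μ : Measure E, IsProbabilityMeasure μ ∧ μ.map T = μ ∧
      μ (closure {y | ∃ n : ℕ, y = T^[n] x}) = 1 := by
  let m : ℕ → ProbabilityMeasure E := fun N ↦ ⟨empiricalMeasure T x N, inferInstance⟩
  obtain ⟨μ, -, hμ⟩ := isCompact_univ.ultrafilter_le_nhds ((hyperfilter ℕ).map m) (by simp)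
  have hμ : Tendsto m (hyperfilter ℕ) (𝓝 μ) := hμ
  have h_top : (hyperfilter ℕ : Filter ℕ) ≤ atTop := Nat.hyperfilter_le_atTop
  have h_lim (f : E →ᵇ ℝ) : Tendsto (fun N ↦ birkhoffAverage ℝ T f (N + 1) x) (hyperfilter ℕ)
      (𝓝 (∫ y, f y ∂(μ : Measure E))) := by
    simpa only [m, ProbabilityMeasure.coe_mk, integral_empiricalMeasure] using
      ProbabilityMeasure.tendsto_iff_forall_integral_tendsto.mp hμ f
  refine ⟨μ, inferInstance, ?_, ?_⟩
  · have : IsProbabilityMeasure ((μ : Measure E).map T) :=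
      Measure.isProbabilityMeasure_map hT.aemeasurable
    refine ext_of_forall_integral_eq_of_IsFiniteMeasure fun f ↦ ?_
    rw [integral_map hT.aemeasurable f.continuous.aestronglyMeasurable]
    refine sub_eq_zero.mp (tendsto_nhds_unique
      ((h_lim (f.compContinuous ⟨T, hT⟩)).sub (h_lim f)) ?_)
    have hb : Bornology.IsBounded (Set.range fun n ↦ f (T^[n] x)) :=
      f.isBounded_range.subset (Set.range_subset_iff.mpr fun n ↦ Set.mem_range_self _)
    have hlim := (tendsto_birkhoffAverage_apply_sub_birkhoffAverage ℝ hb).comp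
      (tendsto_add_atTop_nat 1) |>.mono_left h_top
    refine hlim.congr fun N ↦ ?_
    simp [birkhoffAverage, birkhoffSum, ← Function.iterate_succ_apply,
      Function.iterate_succ_apply']
  · refine le_antisymm prob_le_one ?_
    have hle := ProbabilityMeasure.limsup_measure_closed_le_of_tendsto hμ
      (isClosed_closure (s := {y | ∃ n : ℕ, y = T^[n] x}))
    have hone (N : ℕ) : (m N : Measure E) (closure {y | ∃ n : ℕ, y = T^[n] x}) = 1 :=
      empiricalMeasure_apply_eq_one (fun k ↦ subset_closure (Set.mem_ofPred.mpr ⟨k, rfl⟩)) N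
    simpa only [hone, limsup_const] using hle

theorem continuous_shift {A : Type*} [TopologicalSpace A] :
    Continuous (shift : (ℕ → A) → ℕ → A) :=
  continuous_pi fun n ↦ continuous_apply (n + 1)

theorem shift_iterate_comp {A B : Type*} (g : A → B) (x : ℕ → A) (n : ℕ) :
    shift^[n] (g ∘ x) = g ∘ shift^[n] x := by
  induction n with
  | zero => rfl
  | succ n ih => rw [Function.iterate_succ_apply', ih, Function.iterate_succ_apply']; rfl

theorem comp_mem_orbitClosure {A B : Type*} [TopologicalSpace A] [TopologicalSpace B] {g : A → B}
    (hg : Continuous g) {b x : ℕ → A} (hx : x ∈ orbitClosure b) :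
    g ∘ x ∈ orbitClosure (g ∘ b) := by
  refine map_mem_closure (f := fun x : ℕ → A ↦ g ∘ x)
    (continuous_pi fun n ↦ hg.comp (continuous_apply n)) hx ?_
  rintro _ ⟨n, rfl⟩
  exact ⟨n, (shift_iterate_comp g b n).symm⟩

/-- Letterwise images of invariant probability measures carried by an orbit closure are such. -/
theorem map_comp_invariant {A B : Type*} [TopologicalSpace A] [MeasurableSpace A]
    [SecondCountableTopology A] [BorelSpace A] [TopologicalSpace B] [MeasurableSpace B]
    [SecondCountableTopology B] [BorelSpace B]
    {g : A → B} (hg : Continuous g) {b : ℕ → A} {μ : Measure (ℕ → A)}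
    (hμ : IsProbabilityMeasure μ ∧ μ.map shift = μ ∧ μ (orbitClosure b) = 1) :
    IsProbabilityMeasure (μ.map (g ∘ ·)) ∧ (μ.map (g ∘ ·)).map shift = μ.map (g ∘ ·) ∧
      μ.map (g ∘ ·) (orbitClosure (g ∘ b)) = 1 := by
  obtain ⟨hprob, hinv, hfull⟩ := hμ
  have hG : Measurable (fun x : ℕ → A ↦ g ∘ x) :=
    measurable_pi_lambda _ fun n ↦ hg.measurable.comp (measurable_pi_apply n)
  have hmap : IsProbabilityMeasure (μ.map (g ∘ ·)) :=
    Measure.isProbabilityMeasure_map hG.aemeasurable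
  refine ⟨hmap, ?_, le_antisymm prob_le_one ?_⟩
  · conv_rhs => rw [← hinv]
    rw [Measure.map_map continuous_shift.measurable hG,
      Measure.map_map hG continuous_shift.measurable]
    rfl
  · have hmeas : MeasurableSet (orbitClosure (g ∘ b)) := isClosed_closure.measurableSet
    rw [Measure.map_apply hG hmeas, ← hfull]
    exact measure_mono fun x hx ↦ comp_mem_orbitClosure hg hx

theorem PadicInt.norm_sub_val_toZModPow_le {p : ℕ} [Fact p.Prime] (n : ℕ) (x : ℤ_[p]) :
    ‖((PadicInt.toZModPow n x).val : ℤ_[p]) - x‖ ≤ (p : ℝ) ^ (-n : ℤ) := by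
  have : NeZero (p ^ n) := ⟨pow_ne_zero _ (Fact.out : p.Prime).ne_zero⟩
  rw [PadicInt.norm_le_pow_iff_mem_span_pow, ← PadicInt.ker_toZModPow, RingHom.mem_ker]
  simp

theorem PadicInt.continuous_toZModPow {p : ℕ} [Fact p.Prime] (n : ℕ) :
    Continuous (PadicInt.toZModPow n : ℤ_[p] → ZMod (p ^ n)) := by
  refine IsLocallyConstant.continuous ((IsLocallyConstant.iff_eventually_eq _).mpr fun x ↦ ?_)
  have hp : (0 : ℝ) < p := mod_cast (Fact.out : p.Prime).pos
  filter_upwards [Metric.ball_mem_nhds x (zpow_pos hp (-n : ℤ))] with y hy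
  rw [Metric.mem_ball, dist_eq_norm] at hy
  rw [← sub_eq_zero, ← map_sub, ← RingHom.mem_ker, PadicInt.ker_toZModPow,
    ← PadicInt.norm_le_pow_iff_mem_span_pow]
  exact hy.le

theorem PadicInt.tendsto_val_toZModPow {p : ℕ} [Fact p.Prime] (x : ℤ_[p]) :
    Tendsto (fun n ↦ ((PadicInt.toZModPow n x).val : ℤ_[p])) atTop (𝓝 x) := by
  rw [tendsto_iff_norm_sub_tendsto_zero]
  have hp : (1 : ℝ) < p := mod_cast (Fact.out : p.Prime).one_lt
  refine squeeze_zero (fun _ ↦ norm_nonneg _)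
    (fun n ↦ PadicInt.norm_sub_val_toZModPow_le n x) ?_
  simpa only [zpow_neg, zpow_natCast, ← inv_pow] using
    tendsto_pow_atTop_nhds_zero_of_lt_one (by positivity) (inv_lt_one_of_one_lt₀ hp)

/-- A finite measure on sequences of `p`-adic integers is determined by its reductions modulo
powers of `p`. -/
theorem ext_of_map_toZModPow {p : ℕ} [Fact p.Prime] {μ ν : Measure (ℕ → ℤ_[p])}
    [IsFiniteMeasure μ] [IsFiniteMeasure ν]
    (h : ∀ α : ℕ, μ.map (PadicInt.toZModPow α ∘ ·) = ν.map (PadicInt.toZModPow α ∘ ·)) :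
    μ = ν := by
  refine ext_of_forall_integral_eq_of_IsFiniteMeasure fun f ↦ ?_
  let s (α : ℕ) (z : ℕ → ZMod (p ^ α)) : ℕ → ℤ_[p] := fun n ↦ ((z n).val : ℤ_[p])
  have hs (α : ℕ) : Measurable (s α) := measurable_pi_lambda _ fun n ↦
    (measurable_from_top (f := fun z : ZMod (p ^ α) ↦ (z.val : ℤ_[p]))).comp (measurable_pi_apply n)
  have hG (α : ℕ) :
      Measurable (fun x : ℕ → ℤ_[p] ↦ (PadicInt.toZModPow α ∘ x : ℕ → ZMod (p ^ α))) :=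
    measurable_pi_lambda _ fun n ↦
      (PadicInt.continuous_toZModPow α).measurable.comp (measurable_pi_apply n)
  have hlim (ρ : Measure (ℕ → ℤ_[p])) [IsFiniteMeasure ρ] :
      Tendsto (fun α ↦ ∫ z, f (s α z) ∂(ρ.map (PadicInt.toZModPow α ∘ ·))) atTop
        (𝓝 (∫ x, f x ∂ρ)) := by
    have hf (α : ℕ) : StronglyMeasurable fun z ↦ f (s α z) :=
      (f.continuous.measurable.comp (hs α)).stronglyMeasurable
    simp_rw [integral_map (hG _).aemeasurable (hf _).aestronglyMeasurable]
    refine tendsto_integral_of_dominated_convergence (fun _ ↦ ‖f‖)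
      (fun α ↦ ((hf α).comp_measurable (hG α)).aestronglyMeasurable) (integrable_const _)
      (fun α ↦ .of_forall fun x ↦ f.norm_coe_le_norm _) (.of_forall fun x ↦ ?_)
    exact (f.continuous.tendsto x).comp
      (tendsto_pi_nhds.mpr fun n ↦ PadicInt.tendsto_val_toZModPow (x n))
  refine tendsto_nhds_unique (hlim μ) ?_
  simpa only [h] using hlim ν

/-- If for every `α ≥ 0` there is exactly one shift-invariant Borel probability measure
giving full mass to the orbit closure of the reduction `a mod p^α` (unique ergodicity at
every level), then there is exactly one shift-invariant Borel probability measure giving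
full mass to the orbit closure of `a : ℕ → ℤ_p`. -/
theorem uniquelyErgodic_of_levelwise (p : ℕ) [Fact p.Prime] (a : ℕ → ℤ_[p])
    (h : ∀ α : ℕ, ∃! μ : Measure (ℕ → ZMod (p ^ α)),
      IsProbabilityMeasure μ ∧ μ.map shift = μ ∧
        μ (orbitClosure fun n => PadicInt.toZModPow α (a n)) = 1) :
    ∃! μ : Measure (ℕ → ℤ_[p]),
      IsProbabilityMeasure μ ∧ μ.map shift = μ ∧ μ (orbitClosure a) = 1 := by
  obtain ⟨μ, hμ⟩ := exists_invariant_probabilityMeasure_closure_orbit continuous_shift a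
  refine ⟨μ, hμ, fun ν hν ↦ ?_⟩
  have := hμ.1
  have := hν.1
  exact ext_of_map_toZModPow fun α ↦ (h α).unique
    (map_comp_invariant (PadicInt.continuous_toZModPow α) hν)
    (map_comp_invariant (PadicInt.continuous_toZModPow α) hμ)
end

section
/- Define s : ℕ → ℕ by s(0) = 0 and, for n ≥ 0: if s(n) is even then s(2n) = 2·s(n) and s(2n+1) = 2·s(n) + 1; if s(n) is odd then s(2n) = 2·s(n) + 1 and s(2n+1) = 2·s(n). Then the generating function f = ∑_{n≥0} s(n)·xⁿ ∈ ℚ[[x]] is not rational: there do not exist polynomials P, Q ∈ ℚ[x] with Q ≠ 0 such that Q·f = P in ℚ[[x]]. -/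
open Polynomial in
/-- An Eisenstein-type argument at the prime `X - 1`. -/
theorem Polynomial.eq_zero_of_sq_eq_X_sub_one_mul {K : Type*} [Field K] {A Q : K[X]}
    (h : A ^ 2 = (X - C 1) * (Q * A - X * Q ^ 2)) : Q = 0 := by
  induction hn : Q.natDegree using Nat.strong_induction_on generalizing A Q with
  | _ n ih =>
    by_contra hQ
    have hp : Prime (X - C 1 : K[X]) := prime_X_sub_C 1
    obtain ⟨A', rfl⟩ := hp.dvd_of_dvd_pow (Dvd.intro _ h.symm)
    have h' : (X - C 1) * A' ^ 2 = Q * ((X - C 1) * A') - X * Q ^ 2 :=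
      mul_left_cancel₀ hp.ne_zero (by rw [← h]; ring)
    have hdvd : (X - C 1 : K[X]) ∣ X * Q ^ 2 := ⟨Q * A' - A' ^ 2, by linear_combination h'⟩
    have hX : ¬ (X - C 1 : K[X]) ∣ X := by
      rw [dvd_iff_isRoot]
      simp
    obtain ⟨Q', rfl⟩ := hp.dvd_of_dvd_pow ((hp.dvd_or_dvd hdvd).resolve_left hX)
    have hQ' : Q' ≠ 0 := right_ne_zero_of_mul hQ
    refine hQ' (ih Q'.natDegree ?_ (A := A') ?_ rfl)
    · rw [← hn, natDegree_mul hp.ne_zero hQ', natDegree_X_sub_C]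
      omega
    · exact mul_left_cancel₀ hp.ne_zero (by linear_combination h')

namespace PowerSeries

theorem expand_eq_pow_of_zmod {p : ℕ} [Fact p.Prime] (hp : p ≠ 0) (f : (ZMod p)⟦X⟧) :
    expand p hp f = f ^ p := by
  have h := MvPowerSeries.map_frobenius_expand (R := ZMod p) p hp (f := f)
  rwa [ZMod.frobenius_zmod, MvPowerSeries.map_id] at h

/-- The functional equation satisfied by the Thue–Morse power series over `ZMod 2`. -/
theorem thueMorse_functional_equation {t : ℕ → ZMod 2} (h0 : ∀ n, t (2 * n) = t n)
    (h1 : ∀ n, t (2 * n + 1) = t n + 1) :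
    (X - 1) ^ 2 * mk t = (X - 1) ^ 3 * mk t ^ 2 + X := by
  have two_eq_zero : (2 : (ZMod 2)⟦X⟧) = 0 := by
    have h := congrArg C (CharTwo.two_eq_zero (R := ZMod 2))
    rwa [map_ofNat, map_zero] at h
  have key : mk t = (1 + X) * mk t ^ 2 + X * mk 1 ^ 2 := by
    simp_rw [← expand_eq_pow_of_zmod two_ne_zero]
    ext n
    obtain ⟨k, rfl | rfl⟩ := n.even_or_odd'
    · rcases k with _ | k
      · simp [add_mul]
      · have : ¬ 2 ∣ 2 * k + 1 := by omega
        rw [add_mul, one_mul, map_add, map_add, coeff_expand_mul,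
          show 2 * (k + 1) = 2 * k + 1 + 1 by ring, coeff_succ_X_mul, coeff_succ_X_mul,
          coeff_expand_of_not_dvd _ _ _ this, coeff_expand_of_not_dvd _ _ _ this]
        simp [← h0 (k + 1), mul_add]
    · have : ¬ 2 ∣ 2 * k + 1 := by omega
      rw [add_mul, one_mul, map_add, map_add, coeff_succ_X_mul, coeff_succ_X_mul,
        coeff_expand_of_not_dvd _ _ _ this, coeff_expand_mul, coeff_expand_mul]
      simp [h1]
  have hG : (mk 1 : (ZMod 2)⟦X⟧) * (1 - X) = 1 := mk_one_mul_one_sub_eq_one _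
  linear_combination (X - 1) ^ 2 * key + X * (mk 1 * (1 - X) + 1) * hG +
    (X - 1) ^ 2 * mk t ^ 2 * two_eq_zero

/-- The Thue–Morse power series over `ZMod 2` is irrational. -/
theorem thueMorse_not_rational {t : ℕ → ZMod 2} (h0 : ∀ n, t (2 * n) = t n)
    (h1 : ∀ n, t (2 * n + 1) = t n + 1) {P Q : Polynomial (ZMod 2)}
    (h : (Q : (ZMod 2)⟦X⟧) * mk t = P) : Q = 0 := by
  apply Polynomial.eq_zero_of_sq_eq_X_sub_one_mul (A := (Polynomial.X - 1) ^ 2 * P)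
  apply Polynomial.coe_injective
  have hT := thueMorse_functional_equation h0 h1
  push_cast
  simp only [← h, map_one]
  linear_combination -(Q : (ZMod 2)⟦X⟧) ^ 2 * (X - 1) * hT

/-- A rational power series with integer coefficients satisfies a relation with a primitive
integer denominator. -/
theorem exists_isPrimitive_mul_eq_coe {f : ℤ⟦X⟧} {P Q : Polynomial ℚ} (hQ : Q ≠ 0)
    (h : (Q : ℚ⟦X⟧) * map (Int.castRingHom ℚ) f = P) :
    ∃ P' Q' : Polynomial ℤ, Q'.IsPrimitive ∧ (Q' : ℤ⟦X⟧) * f = P' := by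
  obtain ⟨b, -, hb⟩ := IsLocalization.integerNormalization_spec (nonZeroDivisors ℤ) Q
  set R := IsLocalization.integerNormalization (nonZeroDivisors ℤ) Q
  have hR : R ≠ 0 := fun h0 => hQ (IsFractionRing.integerNormalization_eq_zero_iff.mp h0)
  have hmap : map (Int.castRingHom ℚ) ((R : ℤ⟦X⟧) * f) = ((b • P : Polynomial ℚ) : ℚ⟦X⟧) := by
    have hb' : R.map (Int.castRingHom ℚ) = b • Q := hb
    rw [map_mul, ← Polynomial.polynomial_map_coe, hb', zsmul_eq_mul, zsmul_eq_mul,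
      Polynomial.coe_mul, Polynomial.coe_mul, mul_assoc, h]
  refine ⟨trunc (P.natDegree + 1) (R.primPart * f), R.primPart, R.isPrimitive_primPart, ?_⟩
  ext n
  rw [Polynomial.coeff_coe, coeff_trunc]
  split_ifs with hn
  · rfl
  have hcoeff : coeff n ((R : ℤ⟦X⟧) * f) = 0 := by
    have := congrArg (coeff n) hmap
    rw [coeff_map, Polynomial.coeff_coe, Polynomial.coeff_smul,
      Polynomial.coeff_eq_zero_of_natDegree_lt (by omega), smul_zero] at this
    simpa using this
  rw [R.eq_C_content_mul_primPart, Polynomial.coe_mul, Polynomial.coe_C, mul_assoc,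
    coeff_C_mul] at hcoeff
  exact (mul_eq_zero.mp hcoeff).resolve_left (by simpa [Polynomial.content_eq_zero_iff])

end PowerSeries

theorem Polynomial.IsPrimitive.map_zmod_ne_zero {p : ℕ} (hp : p ≠ 1) {Q : Polynomial ℤ}
    (hQ : Q.IsPrimitive) : Q.map (Int.castRingHom (ZMod p)) ≠ 0 := by
  intro h
  have hdvd : Polynomial.C (p : ℤ) ∣ Q := by
    rw [Polynomial.C_dvd_iff_dvd_coeff]
    intro i
    have := congrArg (Polynomial.coeff · i) h
    simpa [ZMod.intCast_zmod_eq_zero_iff_dvd] using this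
  have := hQ _ hdvd
  rw [Int.isUnit_iff_natAbs_eq] at this
  exact hp (by simpa using this)

/-- The generating function of the Thue–Morse cocycle sequence is not rational. -/
theorem thueMorse_cocycle_gf_not_rational (s : ℕ → ℕ) (hs0 : s 0 = 0)
    (hs : ∀ n : ℕ,
      (Even (s n) → s (2 * n) = 2 * s n ∧ s (2 * n + 1) = 2 * s n + 1) ∧
      (¬ Even (s n) → s (2 * n) = 2 * s n + 1 ∧ s (2 * n + 1) = 2 * s n)) :
    ¬ ∃ (P Q : Polynomial ℚ), Q ≠ 0 ∧
      (Q : PowerSeries ℚ) * PowerSeries.mk (fun n => (s n : ℚ)) = (P : PowerSeries ℚ) := by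
  rintro ⟨P, Q, hQ, h⟩
  have hf : PowerSeries.mk (fun n => (s n : ℚ)) =
      PowerSeries.map (Int.castRingHom ℚ) (PowerSeries.mk fun n => (s n : ℤ)) := by
    ext n
    simp
  rw [hf] at h
  obtain ⟨P', Q', hQ', h'⟩ := PowerSeries.exists_isPrimitive_mul_eq_coe hQ h
  have hodd : ∀ n, ¬ Even (s n) → (s n : ZMod 2) = 1 := fun n hn =>
    ZMod.natCast_eq_one_iff_odd.mpr (Nat.not_even_iff_odd.mp hn)
  have heven : ∀ n, Even (s n) → (s n : ZMod 2) = 0 := fun n hn =>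
    ZMod.natCast_eq_zero_iff_even.mpr hn
  have two_eq_zero : (2 : ZMod 2) = 0 := CharTwo.two_eq_zero
  refine hQ'.map_zmod_ne_zero (p := 2) (by norm_num)
    (PowerSeries.thueMorse_not_rational (t := fun n => (s n : ZMod 2))
      (P := P'.map (Int.castRingHom (ZMod 2))) (fun n => ?_) (fun n => ?_) ?_)
  · by_cases hn : Even (s n)
    · simp [((hs n).1 hn).1, heven n hn]
    · simp [((hs n).2 hn).1, hodd n hn, two_eq_zero]
  · by_cases hn : Even (s n)
    · simp [((hs n).1 hn).2, heven n hn]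
    · simp [((hs n).2 hn).2, hodd n hn, two_eq_zero, one_add_one_eq_two]
  · rw [Polynomial.polynomial_map_coe, Polynomial.polynomial_map_coe, ← h', map_mul]
    congr 1
end
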